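/- With the discrete Fourier setup and the coefficients A_{pq}^{rs} defined from the symmetric kernel modes B̂, the coefficients satisfy the discrete-velocity-method symmetry relations A_{pq}^{rs} = A_{qp}^{rs} = A_{rs}^{pq} for all p,q,r,s ∈ K. -/

import Mathlib

open scoped BigOperators

noncomputable section

/-- The finite set of Fourier modes `K = {k ∈ ℤ^d : |k_i| ≤ n}`. -/
def K (d n : ℕ) : Finset (Fin d → ℤ) := Fintype.piFinset fun _ => Finset.Icc (-(n : ℤ)) n

/-- Integer dot product on `ℤ^d`. -/
def dotZ {d : ℕ} (k p : Fin d → ℤ) : ℤ := ∑ i, k i * p i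

/-- The root of unity power `ω^a = exp(2πi a / N)`. -/
def ω (N : ℕ) (a : ℤ) : ℂ := Complex.exp (2 * Real.pi * Complex.I * a / N)

/-- The indicator `1_N(l)`, equal to `1` if `l ≡ 0 (mod N)` componentwise and `0` otherwise. -/
def indN (N : ℕ) {d : ℕ} (l : Fin d → ℤ) : ℂ := if ∀ i, (N : ℤ) ∣ l i then 1 else 0

/-- The symmetric modulo map: the unique element of `K d n` congruent to `l` modulo `N = 2n+1`
componentwise. -/
def smod (n : ℕ) {d : ℕ} (l : Fin d → ℤ) : Fin d → ℤ :=
  fun i => (l i + n) % (2 * n + 1) - n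

/-- Discrete Fourier coefficients `F̂_k = N^{-d} Σ_{p ∈ K} F_p ω^{-k·p}`. -/
def Fhat (d n : ℕ) (F : (Fin d → ℤ) → ℂ) (k : Fin d → ℤ) : ℂ :=
  ((2 * n + 1 : ℂ) ^ d)⁻¹ * ∑ p ∈ K d n, F p * ω (2 * n + 1) (-(dotZ k p))

/-- The discrete-velocity-method coefficients `A_{pq}^{rs}` obtained from the kernel modes `B̂`. -/
def Acoef (d n : ℕ) (Bh : (Fin d → ℤ) → (Fin d → ℤ) → ℂ) (p q r s : Fin d → ℤ) : ℂ :=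
  ((2 * n + 1 : ℂ) ^ (3 * d))⁻¹ *
    ∑ l ∈ K d n, ∑ m ∈ K d n, ∑ k ∈ K d n, ∑ j ∈ K d n,
      indN (2 * n + 1) (l + m - k - j) * Bh (smod n (l - j)) (smod n (m - j)) *
        ω (2 * n + 1) (-(dotZ l p)) * ω (2 * n + 1) (-(dotZ m q)) *
        ω (2 * n + 1) (dotZ k r) * ω (2 * n + 1) (dotZ j s)

lemma neg_mem_K {d n : ℕ} {l : Fin d → ℤ} (hl : l ∈ K d n) : -l ∈ K d n := by
  simp only [K, Fintype.mem_piFinset, Finset.mem_Icc, Pi.neg_apply] at hl ⊢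
  intro i
  have := hl i
  omega

lemma smod_mem_K {d : ℕ} (n : ℕ) (l : Fin d → ℤ) : smod n l ∈ K d n := by
  simp only [K, smod, Fintype.mem_piFinset, Finset.mem_Icc]
  intro i
  have h₁ := Int.emod_nonneg (l i + n) (show (2 * n + 1 : ℤ) ≠ 0 by omega)
  have h₂ := Int.emod_lt_of_pos (l i + n) (show (0 : ℤ) < 2 * n + 1 by omega)
  omega

lemma smod_congr {d n : ℕ} {l m : Fin d → ℤ} (h : ∀ i, (2 * n + 1 : ℤ) ∣ l i - m i) :
    smod n l = smod n m := by
  funext i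
  have : (l i + n) % (2 * n + 1) = (m i + n) % (2 * n + 1) :=
    Int.emod_eq_emod_iff_emod_sub_eq_zero.2 (Int.emod_eq_zero_of_dvd (by simpa using h i))
  simp only [smod, this]

lemma smod_neg {d : ℕ} (n : ℕ) (l : Fin d → ℤ) : smod n (-l) = -smod n l := by
  funext i
  have h : (-l i + n) % (2 * n + 1) = 2 * n - (l i + n) % (2 * n + 1) := by
    have h₁ := Int.emod_nonneg (l i + n) (show (2 * n + 1 : ℤ) ≠ 0 by omega)
    have h₂ := Int.emod_lt_of_pos (l i + n) (show (0 : ℤ) < 2 * n + 1 by omega)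
    have h₃ := Int.emod_add_mul_ediv (l i + n) (2 * n + 1)
    rw [show -l i + n = 2 * n - (l i + n) % (2 * n + 1)
        + (2 * n + 1) * (-((l i + n) / (2 * n + 1))) by linear_combination h₃,
      Int.add_mul_emod_self_left]
    exact Int.emod_eq_of_lt (by omega) (by omega)
  simp only [smod, Pi.neg_apply, h]
  ring

lemma dotZ_neg {d : ℕ} (k p : Fin d → ℤ) : dotZ (-k) p = -dotZ k p := by
  simp [dotZ]

lemma sum_K_neg {d n : ℕ} (f : (Fin d → ℤ) → ℂ) :
    ∑ l ∈ K d n, f (-l) = ∑ l ∈ K d n, f l :=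
  Finset.sum_nbij' (fun l => -l) (fun l => -l) (fun _ => neg_mem_K) (fun _ => neg_mem_K)
    (by simp) (by simp) (by simp)

lemma sum_K_neg_exchange {d n : ℕ}
    (f : (Fin d → ℤ) → (Fin d → ℤ) → (Fin d → ℤ) → (Fin d → ℤ) → ℂ) :
    ∑ l ∈ K d n, ∑ m ∈ K d n, ∑ k ∈ K d n, ∑ j ∈ K d n, f (-k) (-j) (-l) (-m)
      = ∑ l ∈ K d n, ∑ m ∈ K d n, ∑ k ∈ K d n, ∑ j ∈ K d n, f l m k j := by
  have h := Finset.sum_comm (s := K d n ×ˢ K d n) (t := K d n ×ˢ K d n)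
    (f := fun x y => f (-y.1) (-y.2) (-x.1) (-x.2))
  simp only [Finset.sum_product] at h
  rw [h]
  refine (sum_K_neg _).symm.trans (Finset.sum_congr rfl fun l _ => ?_)
  refine (sum_K_neg _).symm.trans (Finset.sum_congr rfl fun m _ => ?_)
  refine (sum_K_neg _).symm.trans (Finset.sum_congr rfl fun k _ => ?_)
  refine (sum_K_neg _).symm.trans (Finset.sum_congr rfl fun j _ => ?_)
  simp only [neg_neg]

/-- The convolution weight is invariant under exchanging `(l, m)` with `(-k, -j)`. -/
lemma indN_mul_kernel_exchange {d n : ℕ} {Bh : (Fin d → ℤ) → (Fin d → ℤ) → ℂ}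
    (hsym1 : ∀ l ∈ K d n, ∀ m ∈ K d n, Bh l m = Bh m l)
    (hsym2 : ∀ l ∈ K d n, ∀ m ∈ K d n, Bh l m = Bh l (-m)) (l m k j : Fin d → ℤ) :
    indN (2 * n + 1) (-k + -j - -l - -m) * Bh (smod n (-k - -m)) (smod n (-j - -m))
      = indN (2 * n + 1) (l + m - k - j) * Bh (smod n (l - j)) (smod n (m - j)) := by
  rw [show -k + -j - -l - -m = l + m - k - j by abel, show -j - -m = m - j by abel]
  by_cases h : ∀ i, ((2 * n + 1 : ℕ) : ℤ) ∣ (l + m - k - j) i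
  · have hcongr : smod n (-k - -m) = -smod n (l - j) := by
      rw [← smod_neg]
      refine smod_congr fun i => ?_
      have := h i
      push_cast at this
      convert this using 1
      simp only [Pi.sub_apply, Pi.neg_apply, Pi.add_apply]
      ring
    have ha := smod_mem_K n (l - j)
    have hb := smod_mem_K n (m - j)
    rw [hcongr, hsym1 _ (neg_mem_K ha) _ hb, ← hsym2 _ hb _ ha, hsym1 _ hb _ ha]
  · simp only [indN, if_neg h, zero_mul]

/-- The coefficients `A_{pq}^{rs}` satisfy the discrete-velocity-method symmetry relations. -/
theorem Acoef_symm (d n : ℕ) (hd : 1 ≤ d) (hn : 1 ≤ n)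
    (Bh : (Fin d → ℤ) → (Fin d → ℤ) → ℂ)
    (hsym1 : ∀ l ∈ K d n, ∀ m ∈ K d n, Bh l m = Bh m l)
    (hsym2 : ∀ l ∈ K d n, ∀ m ∈ K d n, Bh l m = Bh l (-m))
    (p q r s : Fin d → ℤ) (hp : p ∈ K d n) (hq : q ∈ K d n)
    (hr : r ∈ K d n) (hs : s ∈ K d n) :
    Acoef d n Bh p q r s = Acoef d n Bh q p r s
      ∧ Acoef d n Bh p q r s = Acoef d n Bh r s p q := by
  constructor
  · unfold Acoef
    rw [Finset.sum_comm]
    refine congrArg _ ?_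
    refine Finset.sum_congr rfl fun m _ => Finset.sum_congr rfl fun l _ =>
      Finset.sum_congr rfl fun k _ => Finset.sum_congr rfl fun j _ => ?_
    rw [hsym1 _ (smod_mem_K n _) _ (smod_mem_K n _), add_comm l m]
    ring
  · unfold Acoef
    refine congrArg _ ?_
    rw [← sum_K_neg_exchange (f := fun l m k j =>
      indN (2 * n + 1) (l + m - k - j) * Bh (smod n (l - j)) (smod n (m - j)) *
        ω (2 * n + 1) (-(dotZ l r)) * ω (2 * n + 1) (-(dotZ m s)) *
        ω (2 * n + 1) (dotZ k p) * ω (2 * n + 1) (dotZ j q))]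
    refine Finset.sum_congr rfl fun l _ => Finset.sum_congr rfl fun m _ =>
      Finset.sum_congr rfl fun k _ => Finset.sum_congr rfl fun j _ => ?_
    simp only [← indN_mul_kernel_exchange hsym1 hsym2 l m k j, dotZ_neg, neg_neg]
    ring
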